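/- The gradient of the expected consumer surplus E is Lipschitz continuous with respect to the Euclidean norm with constant 1/(min_{1≤j≤m} μ_j): for all p, q ∈ ℝ^n, ‖∇E(p) − ∇E(q)‖₂ ≤ (1/min_j μ_j)·‖p − q‖₂. -/

import Mathlib

open Finset

/-- Sum of exponentiated utilities within group `j`. -/
noncomputable def groupSum {n m : ℕ} (grp : Fin n → Fin m) (a : Fin n → ℝ) (μ : Fin m → ℝ)
    (p : EuclideanSpace ℝ (Fin n)) (j : Fin m) : ℝ :=
  ∑ k ∈ Finset.univ.filter (fun k => grp k = j), Real.exp ((a k - p k) / μ j)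

/-- The nested-logit partition function. -/
noncomputable def partitionFun {n m : ℕ} (grp : Fin n → Fin m) (a : Fin n → ℝ) (μ : Fin m → ℝ)
    (p : EuclideanSpace ℝ (Fin n)) : ℝ :=
  ∑ h : Fin m, (groupSum grp a μ p h) ^ (μ h)

/-- The expected consumer surplus `E(p)`. -/
noncomputable def surplus {n m : ℕ} (grp : Fin n → Fin m) (a : Fin n → ℝ) (μ : Fin m → ℝ)
    (p : EuclideanSpace ℝ (Fin n)) : ℝ :=
  Real.log (partitionFun grp a μ p)

section WeightedSums

/-- A weighted second moment splits into a scaled variance and a squared shift of the mean. -/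
lemma sum_mul_sq_scaled_deviation {ι : Type*} (s : Finset ι) (r v : ι → ℝ)
    (hr : ∑ i ∈ s, r i = 1) (c b : ℝ) :
    ∑ i ∈ s, r i * ((v i - ∑ k ∈ s, r k * v k) / c + ((∑ k ∈ s, r k * v k) - b)) ^ 2 =
      (∑ i ∈ s, r i * v i ^ 2 - (∑ k ∈ s, r k * v k) ^ 2) / c ^ 2 +
        ((∑ k ∈ s, r k * v k) - b) ^ 2 := by
  set A := ∑ k ∈ s, r k * v k with hA
  have expand : ∀ i ∈ s, r i * ((v i - A) / c + (A - b)) ^ 2 =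
      (1 / c ^ 2) * (r i * v i ^ 2) + (2 * (A - b) / c - 2 * A / c ^ 2) * (r i * v i) +
        (A ^ 2 / c ^ 2 - 2 * A * (A - b) / c + (A - b) ^ 2) * r i := fun i _ => by ring
  rw [sum_congr rfl expand, sum_add_distrib, sum_add_distrib, ← mul_sum, ← mul_sum, ← mul_sum,
    hr, ← hA]
  ring

lemma sq_sum_mul_le_sum_mul_sq {ι : Type*} (s : Finset ι) (r v : ι → ℝ)
    (hr0 : ∀ i ∈ s, 0 ≤ r i) (hr : ∑ i ∈ s, r i = 1) :
    (∑ i ∈ s, r i * v i) ^ 2 ≤ ∑ i ∈ s, r i * v i ^ 2 := by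
  have h := sum_mul_sq_scaled_deviation s r v hr 1 (∑ i ∈ s, r i * v i)
  have h0 : 0 ≤ ∑ i ∈ s, r i * ((v i - ∑ k ∈ s, r k * v k) / 1 +
      ((∑ k ∈ s, r k * v k) - ∑ i ∈ s, r i * v i)) ^ 2 :=
    sum_nonneg fun i hi => mul_nonneg (hr0 i hi) (sq_nonneg _)
  rw [h] at h0
  simp only [one_pow, div_one, sub_self] at h0
  linarith

/-- Second-moment bound for a two-level probability distribution: `Q` over the groups and `r`
within each group. -/
lemma sum_nested_deviation_sq_le {ι κ : Type*} [Fintype ι] [Fintype κ] [DecidableEq κ]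
    (g : ι → κ) (Q : κ → ℝ) (r v : ι → ℝ) (μ : κ → ℝ) (c : ℝ) (hc : 0 < c)
    (hcμ : ∀ j, c ≤ μ j) (hc1 : c ≤ 1) (hQ0 : ∀ j, 0 ≤ Q j) (hQ : ∑ j, Q j = 1)
    (hr0 : ∀ i, 0 ≤ r i) (hr : ∀ j, ∑ i with g i = j, r i = 1)
    (A : κ → ℝ) (hA : ∀ j, A j = ∑ i with g i = j, r i * v i) :
    ∑ i, (r i * Q (g i) *
      ((v i - A (g i)) / μ (g i) + (A (g i) - ∑ j, Q j * A j))) ^ 2 ≤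
      (1 / c ^ 2) * ∑ i, v i ^ 2 := by
  set B := ∑ j, Q j * A j with hB
  have hr1 : ∀ i, r i ≤ 1 := fun i => by
    rw [← hr (g i)]
    exact single_le_sum (f := r) (fun k _ => hr0 k) (by simp)
  have hQ1 : ∀ j, Q j ≤ 1 := fun j => by
    rw [← hQ]
    exact single_le_sum (fun k _ => hQ0 k) (mem_univ j)
  have hP0 : ∀ i, 0 ≤ r i * Q (g i) := fun i => mul_nonneg (hr0 i) (hQ0 _)
  have hP1 : ∀ i, r i * Q (g i) ≤ 1 := fun i => mul_le_one₀ (hr1 i) (hQ0 _) (hQ1 _)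
  have hone : 1 ≤ 1 / c ^ 2 := by
    rw [le_div_iff₀ (by positivity), one_mul]
    exact pow_le_one₀ hc.le hc1
  calc _ ≤ ∑ i, r i * Q (g i) * ((v i - A (g i)) / μ (g i) + (A (g i) - B)) ^ 2 := by
        refine sum_le_sum fun i _ => ?_
        rw [mul_pow]
        refine mul_le_mul_of_nonneg_right ?_ (sq_nonneg _)
        nlinarith [hP0 i, hP1 i]
    _ = ∑ j, Q j * ((∑ i with g i = j, r i * v i ^ 2 - A j ^ 2) / μ j ^ 2 + (A j - B) ^ 2) := by
        rw [← sum_fiberwise univ g]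
        refine sum_congr rfl fun j _ => ?_
        rw [hA j, ← sum_mul_sq_scaled_deviation _ r v (hr j), mul_sum]
        refine sum_congr rfl fun i hi => ?_
        obtain rfl : g i = j := (mem_filter.1 hi).2
        rw [hA]
        ring
    _ = ∑ j, Q j * ((∑ i with g i = j, r i * v i ^ 2 - A j ^ 2) / μ j ^ 2) +
          (∑ j, Q j * A j ^ 2 - B ^ 2) := by
        have h := sum_mul_sq_scaled_deviation univ Q A hQ 1 B
        simp only [← hB, div_one, sub_self, add_zero, one_pow, ne_eq, OfNat.ofNat_ne_zero,
          not_false_eq_true, zero_pow] at h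
        rw [← h, ← sum_add_distrib]
        exact sum_congr rfl fun j _ => by ring
    _ ≤ ∑ j, Q j * ((∑ i with g i = j, r i * v i ^ 2 - A j ^ 2) / μ j ^ 2) +
          ∑ j, Q j * A j ^ 2 := by linarith [sq_nonneg B]
    _ ≤ ∑ j, Q j * ((1 / c ^ 2) * ∑ i with g i = j, r i * v i ^ 2) := by
        rw [← sum_add_distrib]
        refine sum_le_sum fun j _ => ?_
        rw [← mul_add]
        refine mul_le_mul_of_nonneg_left ?_ (hQ0 j)
        have hvar := sq_sum_mul_le_sum_mul_sq {i | g i = j} r v (fun i _ => hr0 i) (hr j)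
        rw [← hA] at hvar
        have hμ : 1 / μ j ^ 2 ≤ 1 / c ^ 2 := by
          have := hcμ j
          gcongr
        rw [div_eq_mul_one_div]
        nlinarith [mul_le_mul_of_nonneg_left hμ (sub_nonneg.2 hvar),
          mul_le_mul_of_nonneg_right hone (sq_nonneg (A j))]
    _ = (1 / c ^ 2) * ∑ i, r i * Q (g i) * v i ^ 2 := by
        rw [← sum_fiberwise univ g, mul_sum]
        refine sum_congr rfl fun j _ => ?_
        rw [mul_left_comm, mul_sum]
        congr 1
        refine sum_congr rfl fun i hi => ?_
        obtain rfl : g i = j := (mem_filter.1 hi).2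
        ring
    _ ≤ _ := by
        refine mul_le_mul_of_nonneg_left (sum_le_sum fun i _ => ?_) (by positivity)
        exact mul_le_of_le_one_left (sq_nonneg _) (hP1 i)

end WeightedSums

section NestedLogit

variable {n m : ℕ} (grp : Fin n → Fin m) (a : Fin n → ℝ) (μ : Fin m → ℝ)

/-- Probability of choosing product `i` given that its group is chosen. -/
noncomputable def condProb (p : EuclideanSpace ℝ (Fin n)) (i : Fin n) : ℝ :=
  Real.exp ((a i - p i) / μ (grp i)) / groupSum grp a μ p (grp i)

/-- Probability of choosing group `j`. -/
noncomputable def groupProb (p : EuclideanSpace ℝ (Fin n)) (j : Fin m) : ℝ :=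
  groupSum grp a μ p j ^ μ j / partitionFun grp a μ p

/-- Mean of `v` over group `j` under the conditional choice probabilities. -/
noncomputable def groupMean (p v : EuclideanSpace ℝ (Fin n)) (j : Fin m) : ℝ :=
  ∑ i with grp i = j, condProb grp a μ p i * v i

/-- Mean of `v` under the nested-logit choice probabilities. -/
noncomputable def overallMean (p v : EuclideanSpace ℝ (Fin n)) : ℝ :=
  ∑ j, groupProb grp a μ p j * groupMean grp a μ p v j

variable {grp}

lemma groupSum_pos (hgrp : Function.Surjective grp) (p : EuclideanSpace ℝ (Fin n)) (j : Fin m) :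
    0 < groupSum grp a μ p j := by
  obtain ⟨i, hi⟩ := hgrp j
  exact sum_pos (fun k _ => Real.exp_pos _) ⟨i, by simp [hi]⟩

lemma partitionFun_pos (hm : 0 < m) (hgrp : Function.Surjective grp)
    (p : EuclideanSpace ℝ (Fin n)) : 0 < partitionFun grp a μ p :=
  sum_pos (fun j _ => Real.rpow_pos_of_pos (groupSum_pos a μ hgrp p j) _)
    ⟨⟨0, hm⟩, mem_univ _⟩

lemma sum_condProb (hgrp : Function.Surjective grp) (p : EuclideanSpace ℝ (Fin n)) (j : Fin m) :
    ∑ i with grp i = j, condProb grp a μ p i = 1 := by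
  have h : ∀ i ∈ univ.filter (fun i => grp i = j), condProb grp a μ p i =
      Real.exp ((a i - p i) / μ j) / groupSum grp a μ p j := fun i hi => by
    rw [condProb, (mem_filter.1 hi).2]
  rw [sum_congr rfl h, ← sum_div]
  exact div_self (groupSum_pos a μ hgrp p j).ne'

lemma sum_groupProb (hm : 0 < m) (hgrp : Function.Surjective grp)
    (p : EuclideanSpace ℝ (Fin n)) : ∑ j, groupProb grp a μ p j = 1 := by
  simp only [groupProb]
  rw [← sum_div]
  exact div_self (partitionFun_pos a μ hm hgrp p).ne'

lemma overallMean_eq_sum (p v : EuclideanSpace ℝ (Fin n)) :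
    overallMean grp a μ p v = ∑ i, condProb grp a μ p i * groupProb grp a μ p (grp i) * v i := by
  rw [← sum_fiberwise univ grp, overallMean]
  refine sum_congr rfl fun j _ => ?_
  rw [groupMean, mul_sum]
  refine sum_congr rfl fun i hi => ?_
  rw [(mem_filter.1 hi).2]
  ring

lemma hasDerivAt_exp_line (p v : EuclideanSpace ℝ (Fin n)) (i : Fin n) (c t : ℝ) :
    HasDerivAt (fun t : ℝ => Real.exp ((a i - (p + t • v) i) / c))
      (-(Real.exp ((a i - (p + t • v) i) / c) * v i / c)) t := by
  have h : HasDerivAt (fun t : ℝ => (a i - (p + t • v) i) / c) (-v i / c) t := by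
    simp only [PiLp.add_apply, PiLp.smul_apply, smul_eq_mul]
    have h0 := ((((hasDerivAt_id t).mul_const (v i)).const_add (p i)).const_sub (a i)).div_const c
    simpa using h0
  convert! h.exp using 1
  ring

lemma hasDerivAt_groupSum_line (hgrp : Function.Surjective grp)
    (p v : EuclideanSpace ℝ (Fin n)) (j : Fin m) (t : ℝ) :
    HasDerivAt (fun t : ℝ => groupSum grp a μ (p + t • v) j)
      (-(groupSum grp a μ (p + t • v) j * groupMean grp a μ (p + t • v) v j / μ j)) t := by
  have h := HasDerivAt.fun_sum (u := univ.filter fun k => grp k = j) fun k _ =>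
    hasDerivAt_exp_line a p v k (μ j) t
  convert! h using 1
  rw [sum_neg_distrib, ← sum_div, groupMean, mul_sum]
  congr 2
  refine sum_congr rfl fun i hi => ?_
  have hS := (groupSum_pos a μ hgrp (p + t • v) j).ne'
  rw [condProb, (mem_filter.1 hi).2]
  field_simp

lemma hasDerivAt_groupSum_rpow_line (hgrp : Function.Surjective grp) (hμ0 : ∀ j, 0 < μ j)
    (p v : EuclideanSpace ℝ (Fin n)) (j : Fin m) (t : ℝ) :
    HasDerivAt (fun t : ℝ => groupSum grp a μ (p + t • v) j ^ μ j)
      (-(groupSum grp a μ (p + t • v) j ^ μ j * groupMean grp a μ (p + t • v) v j)) t := by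
  have hS := (groupSum_pos a μ hgrp (p + t • v) j).ne'
  convert! (hasDerivAt_groupSum_line a μ hgrp p v j t).rpow_const (p := μ j) (Or.inl hS) using 1
  have := (hμ0 j).ne'
  rw [Real.rpow_sub_one hS]
  field_simp

lemma hasDerivAt_partitionFun_line (hm : 0 < m) (hgrp : Function.Surjective grp)
    (hμ0 : ∀ j, 0 < μ j) (p v : EuclideanSpace ℝ (Fin n)) (t : ℝ) :
    HasDerivAt (fun t : ℝ => partitionFun grp a μ (p + t • v))
      (-(partitionFun grp a μ (p + t • v) * overallMean grp a μ (p + t • v) v)) t := by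
  have h := HasDerivAt.fun_sum (u := univ) fun j _ =>
    hasDerivAt_groupSum_rpow_line a μ hgrp hμ0 p v j t
  convert! h using 1
  have hZ := (partitionFun_pos a μ hm hgrp (p + t • v)).ne'
  rw [sum_neg_distrib, overallMean, mul_sum]
  congr 1
  refine sum_congr rfl fun j _ => ?_
  rw [groupProb]
  field_simp

lemma hasDerivAt_surplus_line (hm : 0 < m) (hgrp : Function.Surjective grp)
    (hμ0 : ∀ j, 0 < μ j) (p v : EuclideanSpace ℝ (Fin n)) (t : ℝ) :
    HasDerivAt (fun t : ℝ => surplus grp a μ (p + t • v))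
      (-overallMean grp a μ (p + t • v) v) t := by
  have hZ := (partitionFun_pos a μ hm hgrp (p + t • v)).ne'
  convert! (hasDerivAt_partitionFun_line a μ hm hgrp hμ0 p v t).log hZ using 1
  field_simp

lemma hasDerivAt_choiceProb_line (hm : 0 < m) (hgrp : Function.Surjective grp)
    (hμ0 : ∀ j, 0 < μ j) (p v : EuclideanSpace ℝ (Fin n)) (i : Fin n) (t : ℝ) :
    HasDerivAt
      (fun t : ℝ => -(condProb grp a μ (p + t • v) i * groupProb grp a μ (p + t • v) (grp i)))
      (condProb grp a μ (p + t • v) i * groupProb grp a μ (p + t • v) (grp i) *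
        ((v i - groupMean grp a μ (p + t • v) v (grp i)) / μ (grp i) +
          (groupMean grp a μ (p + t • v) v (grp i) - overallMean grp a μ (p + t • v) v))) t := by
  have hS := (groupSum_pos a μ hgrp (p + t • v) (grp i)).ne'
  have hZ := (partitionFun_pos a μ hm hgrp (p + t • v)).ne'
  have hμ := (hμ0 (grp i)).ne'
  have h := (((hasDerivAt_exp_line a p v i (μ (grp i)) t).fun_div
    (hasDerivAt_groupSum_line a μ hgrp p v (grp i) t) hS).fun_mul
    ((hasDerivAt_groupSum_rpow_line a μ hgrp hμ0 p v (grp i) t).fun_div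
      (hasDerivAt_partitionFun_line a μ hm hgrp hμ0 p v t) hZ)).fun_neg
  convert! h using 1
  simp only [condProb, groupProb]
  field_simp
  ring

lemma differentiableAt_surplus (hm : 0 < m) (hgrp : Function.Surjective grp)
    (p : EuclideanSpace ℝ (Fin n)) : DifferentiableAt ℝ (surplus grp a μ) p := by
  have hS : ∀ j, DifferentiableAt ℝ (fun p => groupSum grp a μ p j) p := fun j => by
    unfold groupSum
    fun_prop
  have hZ : DifferentiableAt ℝ (fun p => partitionFun grp a μ p) p := by
    unfold partitionFun
    exact DifferentiableAt.fun_sum fun j _ =>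
      (hS j).rpow_const (Or.inl (groupSum_pos a μ hgrp p j).ne')
  exact hZ.log (partitionFun_pos a μ hm hgrp p).ne'

/-- The gradient of the surplus is minus the vector of choice probabilities. -/
lemma gradient_surplus (hm : 0 < m) (hgrp : Function.Surjective grp) (hμ0 : ∀ j, 0 < μ j)
    (p : EuclideanSpace ℝ (Fin n)) :
    gradient (surplus grp a μ) p =
      WithLp.toLp 2 fun i => -(condProb grp a μ p i * groupProb grp a μ p (grp i)) := by
  refine ext_inner_right ℝ fun v => ?_
  have hline : HasDerivAt (fun t : ℝ => surplus grp a μ (p + t • v))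
      (fderiv ℝ (surplus grp a μ) p v) 0 :=
    (differentiableAt_surplus a μ hm hgrp p).hasFDerivAt.hasLineDerivAt v
  have hval := hline.unique (hasDerivAt_surplus_line a μ hm hgrp hμ0 p v 0)
  rw [zero_smul, add_zero, overallMean_eq_sum] at hval
  rw [← InnerProductSpace.toDual_apply_apply (𝕜 := ℝ), toDual_gradient, hval, PiLp.inner_apply,
    ← sum_neg_distrib]
  refine sum_congr rfl fun i _ => ?_
  simp only [RCLike.inner_apply, conj_trivial]
  ring

end NestedLogit

/-- The gradient of the expected consumer surplus `E` is Lipschitz continuous w.r.t. the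
Euclidean norm with constant `1 / min_j μ_j`. -/
theorem surplus_gradient_lipschitz
    {n m : ℕ} (hm : 0 < m) (grp : Fin n → Fin m) (hgrp : Function.Surjective grp)
    (a : Fin n → ℝ) (μ : Fin m → ℝ) (hμ0 : ∀ j, 0 < μ j) (hμ1 : ∀ j, μ j ≤ 1) :
    ∀ p q : EuclideanSpace ℝ (Fin n),
      ‖gradient (surplus grp a μ) p - gradient (surplus grp a μ) q‖ ≤
        (1 / Finset.univ.inf' ⟨⟨0, hm⟩, Finset.mem_univ _⟩ μ) * ‖p - q‖ := by
  intro p q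
  set c := Finset.univ.inf' ⟨⟨0, hm⟩, Finset.mem_univ _⟩ μ
  have hc : 0 < c := (Finset.lt_inf'_iff _).2 fun j _ => hμ0 j
  have hcμ : ∀ j, c ≤ μ j := fun j => Finset.inf'_le _ (mem_univ j)
  have hc1 : c ≤ 1 := (hcμ ⟨0, hm⟩).trans (hμ1 _)
  set v := p - q
  have hderiv : ∀ t : ℝ, HasDerivAt (fun t : ℝ => gradient (surplus grp a μ) (q + t • v))
      (WithLp.toLp 2 fun i =>
        condProb grp a μ (q + t • v) i * groupProb grp a μ (q + t • v) (grp i) *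
        ((v i - groupMean grp a μ (q + t • v) v (grp i)) / μ (grp i) +
          (groupMean grp a μ (q + t • v) v (grp i) - overallMean grp a μ (q + t • v) v))) t := by
    intro t
    simp only [gradient_surplus a μ hm hgrp hμ0]
    exact (PiLp.continuousLinearEquiv 2 ℝ fun _ : Fin n => ℝ).symm.hasFDerivAt.comp_hasDerivAt t
      (hasDerivAt_pi.2 fun i => hasDerivAt_choiceProb_line a μ hm hgrp hμ0 q v i t)
  have hmvt := norm_image_sub_le_of_norm_deriv_le_segment_01' (C := 1 / c * ‖v‖)
    (fun t _ => (hderiv t).hasDerivWithinAt) fun t _ => by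
      refine le_of_sq_le_sq ?_ (by positivity)
      rw [EuclideanSpace.real_norm_sq_eq, mul_pow, div_pow, one_pow,
        EuclideanSpace.real_norm_sq_eq]
      exact sum_nested_deviation_sq_le grp (groupProb grp a μ (q + t • v))
        (condProb grp a μ (q + t • v)) v μ c hc hcμ hc1
        (fun j => div_nonneg (Real.rpow_nonneg (groupSum_pos a μ hgrp _ j).le _)
          (partitionFun_pos a μ hm hgrp _).le)
        (sum_groupProb a μ hm hgrp _)
        (fun i => div_nonneg (Real.exp_pos _).le (groupSum_pos a μ hgrp _ _).le)
        (sum_condProb a μ hgrp _) (groupMean grp a μ (q + t • v) v) fun _ => rfl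
  simpa [v] using hmvt
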